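/- Let Q be a Dynkin quiver. Then there are only finitely many bricks in P(Q)-mod up to isomorphism. -/

import Mathlib

open CategoryTheory Limits Pretriangulated

universe v u

namespace GreenSeqPaper

/-- A finite quiver without loops: finitely many vertices `V` and arrows `A`,
with source and target maps, and no arrow from a vertex to itself. -/
structure LooplessQuiver where
  V : Type
  A : Type
  [fintypeV : Fintype V]
  [decEqV : DecidableEq V]
  [fintypeA : Fintype A]
  src : A → V
  tgt : A → V
  no_loops : ∀ a, src a ≠ tgt a

attribute [instance] LooplessQuiver.fintypeV LooplessQuiver.decEqV LooplessQuiver.fintypeA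

namespace LooplessQuiver

variable (Q : LooplessQuiver)

/-- The arrows of the double quiver `Q̄`: an arrow `a : i ⟶ j` of `Q` (left) together
with a reversed arrow `a* : j ⟶ i` (right). -/
abbrev DArrow := Q.A ⊕ Q.A

/-- Source of an arrow of the double quiver. -/
def dsrc : Q.DArrow → Q.V
  | .inl a => Q.src a
  | .inr a => Q.tgt a

/-- Target of an arrow of the double quiver. -/
def dtgt : Q.DArrow → Q.V
  | .inl a => Q.tgt a
  | .inr a => Q.src a

/-- Generators of the path algebra of the double quiver: one idempotent `e i` for each
vertex `i` and one generator `x a` for each arrow `a` of the double quiver. -/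
abbrev Gen := Q.V ⊕ Q.DArrow

/-- The vertex idempotent `e i` in the free algebra. -/
noncomputable def e (i : Q.V) : FreeAlgebra ℂ Q.Gen := FreeAlgebra.ι ℂ (Sum.inl i)

/-- The arrow generator `x a` in the free algebra. -/
noncomputable def x (a : Q.DArrow) : FreeAlgebra ℂ Q.Gen := FreeAlgebra.ι ℂ (Sum.inr a)

/-- The relations presenting the preprojective algebra `P(Q) = ℂQ̄/(c)`:
the path-algebra relations of the double quiver `Q̄` (orthogonal vertex idempotents
summing to `1`, compatibility of arrows with their endpoints), together with the
preprojective relation `c = Σ_{a ∈ Q₁} (a a* - a* a) = 0`. -/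
inductive Rel : FreeAlgebra ℂ Q.Gen → FreeAlgebra ℂ Q.Gen → Prop
  | vertex_mul (i j : Q.V) : Rel (Q.e i * Q.e j) (if i = j then Q.e i else 0)
  | vertex_sum : Rel (∑ i : Q.V, Q.e i) 1
  | arrow_left (a : Q.DArrow) : Rel (Q.e (Q.dtgt a) * Q.x a) (Q.x a)
  | arrow_right (a : Q.DArrow) : Rel (Q.x a * Q.e (Q.dsrc a)) (Q.x a)
  | preprojective :
      Rel (∑ a : Q.A, (Q.x (Sum.inl a) * Q.x (Sum.inr a) - Q.x (Sum.inr a) * Q.x (Sum.inl a))) 0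

/-- The preprojective algebra `P(Q)` of the quiver `Q`. -/
abbrev Preproj := RingQuot Q.Rel

/-- The image of the vertex idempotent `e i` in `P(Q)`. -/
noncomputable def pe (i : Q.V) : Q.Preproj := RingQuot.mkAlgHom ℂ Q.Rel (Q.e i)

/-- The image of the arrow generator `x a` in `P(Q)`. -/
noncomputable def px (a : Q.DArrow) : Q.Preproj := RingQuot.mkAlgHom ℂ Q.Rel (Q.x a)

/-- The symmetric bilinear form `(x, y) = 2 Σ_i x_i y_i - Σ_{a : i → j ∈ Q̄₁} x_i y_j`
on the root lattice `ℤQ₀` (the sum runs over the arrows of the double quiver). -/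
def form (v w : Q.V → ℤ) : ℤ :=
  2 * ∑ i : Q.V, v i * w i -
    ∑ a : Q.A, (v (Q.src a) * w (Q.tgt a) + v (Q.tgt a) * w (Q.src a))

/-- `Q` is of Dynkin type, i.e. its underlying graph is a disjoint union of ADE Dynkin
diagrams; equivalently, the symmetric bilinear form of `Q` is positive definite. -/
def IsDynkin : Prop := ∀ v : Q.V → ℤ, v ≠ 0 → 0 < Q.form v v

end LooplessQuiver

section Modules

open ModuleCat

variable (Q : LooplessQuiver)

-- the scoped instances `ModuleCat.moduleOfAlgebraModule` and
-- `ModuleCat.isScalarTower_of_algebra_moduleCat` give each `P(Q)`-module its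
-- canonical `ℂ`-vector space structure
attribute [local instance] ModuleCat.moduleOfAlgebraModule
  ModuleCat.isScalarTower_of_algebra_moduleCat

/-- A `P(Q)`-module is finite-dimensional if it is so as a `ℂ`-vector space. -/
def LooplessQuiver.FinDim (M : ModuleCat.{0} Q.Preproj) : Prop := FiniteDimensional ℂ M

/-- A `P(Q)`-module is nilpotent if all sufficiently long products of arrows act by zero;
equivalently, all its composition factors are the vertex simples `S₁, …, Sₙ`. -/
def LooplessQuiver.IsNilpotentMod (M : ModuleCat.{0} Q.Preproj) : Prop :=
  ∃ N : ℕ, ∀ l : List Q.DArrow, l.length = N → ∀ m : M, (l.map Q.px).prod • m = 0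

/-- The dimension of the vector space `eᵢ M` attached to the vertex `i` by the
`P(Q)`-module `M` (viewed as a representation of the double quiver). -/
noncomputable def LooplessQuiver.dimAt (M : ModuleCat.{0} Q.Preproj) (i : Q.V) : ℕ :=
  Module.finrank ℂ (Submodule.span ℂ (Set.range fun m : M => Q.pe i • m))

/-- The dimension vector of a `P(Q)`-module, as an element of the root lattice `ℤQ₀`. -/
noncomputable def LooplessQuiver.dimVec (M : ModuleCat.{0} Q.Preproj) : Q.V → ℤ :=
  fun i => (Q.dimAt M i : ℤ)

/-- A brick: a module `M` with `Hom(M, M) = ℂ`, i.e. `M` is nonzero and every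
endomorphism of `M` is multiplication by a scalar. -/
def LooplessQuiver.IsBrick (M : ModuleCat.{0} Q.Preproj) : Prop :=
  (∃ m : M, m ≠ 0) ∧
    ∀ f : M ⟶ M, ∃ c : ℂ, ∀ m : M, f m = algebraMap ℂ Q.Preproj c • m

/-- `Ext¹(M, N) = 0` for `P(Q)`-modules. -/
def LooplessQuiver.Ext1Vanishes (M N : ModuleCat.{0} Q.Preproj) : Prop :=
  Subsingleton (((Ext ℂ (ModuleCat.{0} Q.Preproj) 1).obj (Opposite.op M)).obj N)

/-- A module is rigid if `Ext¹(M, M) = 0`. -/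
def LooplessQuiver.IsRigid (M : ModuleCat.{0} Q.Preproj) : Prop := Q.Ext1Vanishes M M

/-- `dim_ℂ Extⁿ(M, N)` for `P(Q)`-modules. -/
noncomputable def LooplessQuiver.extDim (n : ℕ) (M N : ModuleCat.{0} Q.Preproj) : ℕ :=
  Module.finrank ℂ (((Ext ℂ (ModuleCat.{0} Q.Preproj) n).obj (Opposite.op M)).obj N)

/-- `dim_ℂ Hom(M, N)` for `P(Q)`-modules. -/
noncomputable def LooplessQuiver.homDim (M N : ModuleCat.{0} Q.Preproj) : ℕ :=
  Module.finrank ℂ (M ⟶ N)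

end Modules

namespace LooplessQuiver

section GradedMatrices

variable {Q : LooplessQuiver} {ι : Type} (π : ι → Q.V) {R : Type*}

/-- Pairs of indices lying over the same vertex. -/
abbrev VertexPairs : Type := {p : ι × ι // π p.1 = π p.2}

/-- Matrix positions available to the arrows of the double quiver. -/
abbrev ArrowPairs : Type :=
  {q : Q.DArrow × ι × ι // π q.2.1 = Q.dtgt q.1 ∧ π q.2.2 = Q.dsrc q.1}

section Zero

variable [Zero R]

/-- The matrix preserving the vertex grading with the given entries. -/
def vertexMat (g : VertexPairs π → R) : Matrix ι ι R :=
  Matrix.of fun r c => if h : π r = π c then g ⟨(r, c), h⟩ else 0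

/-- The matrix of an arrow of the double quiver with the given entries. -/
def arrowMat (x : ArrowPairs π → R) (a : Q.DArrow) : Matrix ι ι R :=
  Matrix.of fun r c => if h : π r = Q.dtgt a ∧ π c = Q.dsrc a then x ⟨(a, r, c), h⟩ else 0

/-- The entries of a matrix at the positions preserving the vertex grading. -/
def vertexRes (M : Matrix ι ι R) : VertexPairs π → R := fun p => M p.1.1 p.1.2

/-- The entries of a family of matrices at the positions of the arrows. -/
def arrowRes (f : Q.DArrow → Matrix ι ι R) : ArrowPairs π → R := fun q => f q.1.1 q.1.2.1 q.1.2.2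

theorem vertexMat_apply_of_ne (g : VertexPairs π → R) {r c : ι} (h : π r ≠ π c) :
    vertexMat π g r c = 0 := dif_neg h

theorem arrowMat_apply_of_not (x : ArrowPairs π → R) (a : Q.DArrow) {r c : ι}
    (h : ¬(π r = Q.dtgt a ∧ π c = Q.dsrc a)) : arrowMat π x a r c = 0 := dif_neg h

theorem vertexMat_vertexRes {M : Matrix ι ι R} (hM : ∀ r c, π r ≠ π c → M r c = 0) :
    vertexMat π (vertexRes π M) = M := by
  ext r c
  by_cases h : π r = π c
  · simp [vertexMat, vertexRes, h]
  · simp [vertexMat, h, hM r c h]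

theorem arrowMat_arrowRes {f : Q.DArrow → Matrix ι ι R}
    (hf : ∀ a r c, ¬(π r = Q.dtgt a ∧ π c = Q.dsrc a) → f a r c = 0) :
    arrowMat π (arrowRes π f) = f := by
  ext a r c
  by_cases h : π r = Q.dtgt a ∧ π c = Q.dsrc a
  · simp [arrowMat, arrowRes, h]
  · simp [arrowMat, h, hf a r c h]

@[simp] theorem vertexRes_vertexMat (g : VertexPairs π → R) : vertexRes π (vertexMat π g) = g := by
  ext ⟨p, hp⟩
  simp [vertexMat, vertexRes, hp]

@[simp] theorem arrowRes_arrowMat (x : ArrowPairs π → R) : arrowRes π (arrowMat π x) = x := by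
  ext ⟨q, hq⟩
  simp [arrowMat, arrowRes, hq]

end Zero

section Ring

variable [CommRing R]

theorem vertexMat_add (g h : VertexPairs π → R) :
    vertexMat π (g + h) = vertexMat π g + vertexMat π h := by
  ext r c; by_cases hrc : π r = π c <;> simp [vertexMat, hrc]

theorem vertexMat_smul (t : R) (g : VertexPairs π → R) :
    vertexMat π (t • g) = t • vertexMat π g := by
  ext r c; by_cases hrc : π r = π c <;> simp [vertexMat, hrc]

theorem arrowMat_add (x y : ArrowPairs π → R) (a : Q.DArrow) :
    arrowMat π (x + y) a = arrowMat π x a + arrowMat π y a := by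
  ext r c; by_cases h : π r = Q.dtgt a ∧ π c = Q.dsrc a <;> simp [arrowMat, h]

theorem arrowMat_sub (x y : ArrowPairs π → R) (a : Q.DArrow) :
    arrowMat π (x - y) a = arrowMat π x a - arrowMat π y a := by
  ext r c; by_cases h : π r = Q.dtgt a ∧ π c = Q.dsrc a <;> simp [arrowMat, h]

theorem arrowMat_smul (t : R) (x : ArrowPairs π → R) (a : Q.DArrow) :
    arrowMat π (t • x) a = t • arrowMat π x a := by
  ext r c; by_cases h : π r = Q.dtgt a ∧ π c = Q.dsrc a <;> simp [arrowMat, h]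

variable {S : Type*} [CommRing S]

theorem map_vertexMat (φ : R →+* S) (g : VertexPairs π → R) :
    (vertexMat π g).map φ = vertexMat π (fun p => φ (g p)) := by
  ext r c; by_cases h : π r = π c <;> simp [vertexMat, h]

theorem map_arrowMat (φ : R →+* S) (x : ArrowPairs π → R) (a : Q.DArrow) :
    (arrowMat π x a).map φ = arrowMat π (fun q => φ (x q)) a := by
  ext r c; by_cases h : π r = Q.dtgt a ∧ π c = Q.dsrc a <;> simp [arrowMat, h]

variable [Fintype ι]

/-- The bilinear form underlying the preprojective relation. -/
def moment (f g : Q.DArrow → Matrix ι ι R) : Matrix ι ι R :=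
  ∑ a : Q.A, (f (.inl a) * g (.inr a) - f (.inr a) * g (.inl a))

theorem map_moment (φ : R →+* S) (f g : Q.DArrow → Matrix ι ι R) :
    (moment f g).map φ = moment (fun a => (f a).map φ) (fun a => (g a).map φ) := by
  have (M : Matrix ι ι R) : M.map φ = φ.toAddMonoidHom.mapMatrix M := rfl
  simp only [moment, this, map_sum, map_sub]
  simp only [← this, Matrix.map_mul]

theorem map_moment_arrowMat (φ : R →+* S)
    (x : ArrowPairs π → R) (r c : ι) :
    φ (moment (arrowMat π x) (arrowMat π x) r c) =
      moment (arrowMat π fun q => φ (x q)) (arrowMat π fun q => φ (x q)) r c := by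
  have h := congrFun (congrFun (map_moment φ (arrowMat π x) (arrowMat π x)) r) c
  simp only [map_arrowMat] at h
  exact h

theorem moment_sub_left (f f' g : Q.DArrow → Matrix ι ι R) :
    moment (f - f') g = moment f g - moment f' g := by
  simp only [moment, Pi.sub_apply, sub_mul, ← Finset.sum_sub_distrib]
  exact Finset.sum_congr rfl fun _ _ => by abel

theorem moment_sub_right (f g g' : Q.DArrow → Matrix ι ι R) :
    moment f (g - g') = moment f g - moment f g' := by
  simp only [moment, Pi.sub_apply, mul_sub, ← Finset.sum_sub_distrib]
  exact Finset.sum_congr rfl fun _ _ => by abel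

theorem moment_mul_left (f g : Q.DArrow → Matrix ι ι R) (M : Matrix ι ι R) :
    moment (fun a => M * f a) g = M * moment f g := by
  simp [moment, Finset.mul_sum, mul_sub, mul_assoc]

theorem moment_mul_right (f g : Q.DArrow → Matrix ι ι R) (M : Matrix ι ι R) :
    moment f (fun a => g a * M) = moment f g * M := by
  simp [moment, Finset.sum_mul, sub_mul, mul_assoc]

theorem moment_mul_middle (f g : Q.DArrow → Matrix ι ι R) (M : Matrix ι ι R) :
    moment (fun a => f a * M) g = moment f (fun a => M * g a) := by
  simp [moment, mul_assoc]

/-- The defect of `g` from being a morphism from the representation `y` to the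
representation `x`. -/
def intertwine (x y : ArrowPairs π → R) : (VertexPairs π → R) →ₗ[R] (ArrowPairs π → R) where
  toFun g := arrowRes π fun a => arrowMat π x a * vertexMat π g - vertexMat π g * arrowMat π y a
  map_add' g h := by
    ext q
    simp only [arrowRes, vertexMat_add, mul_add, add_mul, Matrix.sub_apply, Matrix.add_apply,
      Pi.add_apply]
    ring
  map_smul' t g := by
    ext q
    simp [arrowRes, vertexMat_smul, mul_sub]

/-- The derivative at `y` of the preprojective relation. -/
def linMoment (y : ArrowPairs π → R) : (ArrowPairs π → R) →ₗ[R] (VertexPairs π → R) where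
  toFun f := vertexRes π
    (moment (arrowMat π y) (arrowMat π f) + moment (arrowMat π f) (arrowMat π y))
  map_add' f g := by
    ext q
    simp only [vertexRes, moment, arrowMat_add, mul_add, add_mul, Matrix.sub_apply,
      Matrix.sum_apply, Matrix.add_apply, Pi.add_apply, ← Finset.sum_add_distrib]
    exact Finset.sum_congr rfl fun _ _ => by ring
  map_smul' t f := by
    ext q
    simp only [vertexRes, moment, arrowMat_smul, Matrix.sub_apply, Matrix.sum_apply,
      Matrix.add_apply, Pi.smul_apply, ← Finset.sum_add_distrib, Matrix.mul_smul, Matrix.smul_mul,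
      Matrix.smul_apply, smul_eq_mul, RingHom.id_apply, Finset.mul_sum]
    exact Finset.sum_congr rfl fun _ _ => by ring

theorem arrowMat_mul_vertexMat_apply (x : ArrowPairs π → R) (g : VertexPairs π → R) {a : Q.DArrow}
    {r c : ι} (h : ¬(π r = Q.dtgt a ∧ π c = Q.dsrc a)) :
    (arrowMat π x a * vertexMat π g) r c = 0 := by
  rw [Matrix.mul_apply]
  refine Finset.sum_eq_zero fun k _ => ?_
  by_cases hk : π k = π c
  · rw [arrowMat_apply_of_not π x a (hk ▸ h), zero_mul]
  · rw [vertexMat_apply_of_ne π g hk, mul_zero]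

theorem vertexMat_mul_arrowMat_apply (x : ArrowPairs π → R) (g : VertexPairs π → R) {a : Q.DArrow}
    {r c : ι} (h : ¬(π r = Q.dtgt a ∧ π c = Q.dsrc a)) :
    (vertexMat π g * arrowMat π x a) r c = 0 := by
  rw [Matrix.mul_apply]
  refine Finset.sum_eq_zero fun k _ => ?_
  by_cases hk : π r = π k
  · rw [arrowMat_apply_of_not π x a (hk ▸ h), mul_zero]
  · rw [vertexMat_apply_of_ne π g hk, zero_mul]

theorem arrowMat_intertwine (x y : ArrowPairs π → R) (g : VertexPairs π → R) (a : Q.DArrow) :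
    arrowMat π (intertwine π x y g) a =
      arrowMat π x a * vertexMat π g - vertexMat π g * arrowMat π y a := by
  refine congrFun (arrowMat_arrowRes π
    (f := fun a => arrowMat π x a * vertexMat π g - vertexMat π g * arrowMat π y a)
    fun a r c h => ?_) a
  rw [Matrix.sub_apply, arrowMat_mul_vertexMat_apply π x g h, vertexMat_mul_arrowMat_apply π y g h,
    sub_zero]

theorem moment_arrowMat_apply (x y : ArrowPairs π → R) {r c : ι} (h : π r ≠ π c) :
    moment (arrowMat π x) (arrowMat π y) r c = 0 := by
  have key (a b : Q.DArrow) (hab : Q.dtgt a = Q.dsrc b) :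
      (arrowMat π x a * arrowMat π y b) r c = 0 := by
    rw [Matrix.mul_apply]
    refine Finset.sum_eq_zero fun k _ => ?_
    by_cases hr : π r = Q.dtgt a
    · rw [arrowMat_apply_of_not π y b (fun hc => h (by rw [hr, hc.2, hab])), mul_zero]
    · rw [arrowMat_apply_of_not π x a (fun hc => hr hc.1), zero_mul]
  rw [moment, Matrix.sum_apply]
  exact Finset.sum_eq_zero fun a _ => by
    rw [Matrix.sub_apply, key _ _ rfl, key _ _ rfl, sub_zero]

theorem vertexMat_linMoment (y f : ArrowPairs π → R) :
    vertexMat π (linMoment π y f) =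
      moment (arrowMat π y) (arrowMat π f) + moment (arrowMat π f) (arrowMat π y) :=
  vertexMat_vertexRes π (M := moment (arrowMat π y) (arrowMat π f) +
    moment (arrowMat π f) (arrowMat π y)) fun r c h => by
    rw [Matrix.add_apply, moment_arrowMat_apply π y f h, moment_arrowMat_apply π f y h, add_zero]

theorem moment_intertwine (x y : ArrowPairs π → R) (g : VertexPairs π → R)
    (hx : moment (arrowMat π x) (arrowMat π x) = 0)
    (hy : moment (arrowMat π y) (arrowMat π y) = 0) :
    moment (arrowMat π x) (arrowMat π (intertwine π x y g)) +
      moment (arrowMat π (intertwine π x y g)) (arrowMat π y) = 0 := by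
  have h : arrowMat π (intertwine π x y g) =
      (fun a => arrowMat π x a * vertexMat π g) - fun a => vertexMat π g * arrowMat π y a :=
    funext fun a => arrowMat_intertwine π x y g a
  rw [h, moment_sub_left, moment_sub_right, moment_mul_right, moment_mul_left, moment_mul_middle,
    hx, hy]
  simp

theorem linMoment_comp_intertwine (x : ArrowPairs π → R) (g : VertexPairs π → R)
    (hx : moment (arrowMat π x) (arrowMat π x) = 0) :
    linMoment π x (intertwine π x x g) = 0 := by
  rw [← vertexRes_vertexMat π (linMoment π x _), vertexMat_linMoment,
    moment_intertwine π x x g hx hx]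
  rfl

end Ring

end GradedMatrices

end LooplessQuiver

section LinearAlgebra

/-- An exact pair of maps of vector spaces is split exact. -/
theorem exists_homotopy_of_ker_le_range {K U V W : Type*} [Field K] [AddCommGroup U] [Module K U]
    [AddCommGroup V] [Module K V] [AddCommGroup W] [Module K W] (f : U →ₗ[K] V) (g : V →ₗ[K] W)
    (h : LinearMap.ker g ≤ LinearMap.range f) :
    ∃ (s : V →ₗ[K] U) (t : W →ₗ[K] V), f ∘ₗ s + t ∘ₗ g = LinearMap.id := by
  obtain ⟨s₀, hs₀⟩ := f.rangeRestrict.exists_rightInverse_of_surjective f.range_rangeRestrict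
  obtain ⟨s, hs⟩ := s₀.exists_extend
  obtain ⟨t₀, ht₀⟩ := g.rangeRestrict.exists_rightInverse_of_surjective g.range_rangeRestrict
  obtain ⟨t, ht⟩ := ((LinearMap.id - f ∘ₗ s) ∘ₗ t₀).exists_extend
  have hfs (v : V) (hv : v ∈ LinearMap.range f) : f (s v) = v := by
    have h1 : s v = s₀ ⟨v, hv⟩ := LinearMap.congr_fun hs ⟨v, hv⟩
    have h2 := congrArg Subtype.val (LinearMap.congr_fun hs₀ ⟨v, hv⟩)
    rw [h1]
    exact h2
  refine ⟨s, t, LinearMap.ext fun v => ?_⟩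
  have h1 : t (g v) = t₀ (g.rangeRestrict v) - f (s (t₀ (g.rangeRestrict v))) :=
    LinearMap.congr_fun ht (g.rangeRestrict v)
  have h2 : g (t₀ (g.rangeRestrict v)) = g v :=
    congrArg Subtype.val (LinearMap.congr_fun ht₀ (g.rangeRestrict v))
  have h3 := hfs (v - t₀ (g.rangeRestrict v)) (h (by simp [h2]))
  rw [map_sub, map_sub] at h3
  change f (s v) + t (g v) = v
  rw [h1]
  rw [← sub_eq_zero] at h3 ⊢
  rw [← h3]
  abel

variable {κ μ ν : Type*} [Fintype κ] [DecidableEq κ] {k B : Type*} [CommRing k] [CommRing B]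
  [Algebra k B]

/-- Extension of scalars of a linear map between free modules of functions. -/
def extendScalarsPi (B : Type*) [CommRing B] [Algebra k B] (S : (κ → k) →ₗ[k] (μ → k)) :
    (κ → B) →ₗ[B] (μ → B) :=
  ((LinearMap.toMatrix' S).map (algebraMap k B)).mulVecLin

theorem extendScalarsPi_apply (S : (κ → k) →ₗ[k] (μ → k)) (v : κ → k) :
    extendScalarsPi B S (fun i => algebraMap k B (v i)) = fun j => algebraMap k B (S v j) := by
  ext j
  conv_rhs => rw [← LinearMap.toMatrix'_mulVec S v]
  simp [extendScalarsPi, Matrix.mulVec, dotProduct, -LinearMap.toMatrix'_mulVec]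

theorem linearMap_ext_algebraMap {T T' : (κ → B) →ₗ[B] (μ → B)}
    (h : ∀ v : κ → k, T (fun i => algebraMap k B (v i)) = T' (fun i => algebraMap k B (v i))) :
    T = T' := by
  refine LinearMap.pi_ext' fun i => LinearMap.ext_ring ?_
  have : (fun j => algebraMap k B ((Pi.single i 1 : κ → k) j)) = Pi.single i (1 : B) := by
    ext j
    by_cases hj : j = i
    · subst hj; simp
    · simp [hj]
  simpa [this] using h (Pi.single i 1)

end LinearAlgebra

section Krull

variable {B κ μ : Type*} [CommRing B] [IsNoetherianRing B] [Fintype μ]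

/-- A linear equation over a Noetherian ring whose right-hand side admits approximate solutions in
`m` to every `m`-adic order has a solution in `m` after multiplication by an element of `1 + m`. -/
theorem exists_solution_of_approximate (m : Ideal B) (L : (κ → B) →ₗ[B] (μ → B)) (b : μ → B)
    (h : ∀ n : ℕ, ∃ y : κ → B, (∀ i, y i ∈ m) ∧ ∀ j, (b - L y) j ∈ m ^ n) :
    ∃ (r : B) (y : κ → B), r ∈ m ∧ (∀ i, y i ∈ m) ∧ L y = (1 - r) • b := by
  classical
  set N : Submodule B (μ → B) := (Submodule.pi Set.univ fun _ => m).map L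
  have hb : N.mkQ b ∈ (⨅ n : ℕ, m ^ n • ⊤ : Submodule B ((μ → B) ⧸ N)) := by
    rw [Submodule.mem_iInf]
    intro n
    obtain ⟨y, hy, hyb⟩ := h n
    have h1 : N.mkQ (L y) = 0 := (Submodule.Quotient.mk_eq_zero N).2 ⟨y, fun i _ => hy i, rfl⟩
    have h2 : N.mkQ b = N.mkQ (b - L y) := by rw [map_sub, h1, sub_zero]
    rw [h2, LinearMap.pi_apply_eq_sum_univ]
    exact Submodule.sum_mem _ fun j _ => Submodule.smul_mem_smul (hyb j) trivial
  obtain ⟨⟨r, hr⟩, hrb⟩ := (Ideal.mem_iInf_smul_pow_eq_bot_iff m (N.mkQ b)).1 hb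
  have h2 : (1 - r) • b ∈ N := by
    rw [← Submodule.Quotient.mk_eq_zero, sub_smul, one_smul, ← Submodule.mkQ_apply, map_sub,
      map_smul, sub_eq_zero]
    exact hrb.symm
  obtain ⟨y, hy, hyb⟩ := h2
  exact ⟨r, y, hr, fun i => hy i trivial, hyb⟩

end Krull

namespace LooplessQuiver

section Deformation

variable {Q : LooplessQuiver} {ι : Type} (π : ι → Q.V)

theorem vertexMat_apply_mem {R : Type*} [CommRing R] {I : Ideal R} {g : VertexPairs π → R}
    (hg : ∀ p, g p ∈ I) (r c : ι) : vertexMat π g r c ∈ I := by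
  by_cases h : π r = π c
  · simpa [vertexMat, h] using hg ⟨(r, c), h⟩
  · rw [vertexMat_apply_of_ne π g h]
    exact I.zero_mem

theorem arrowMat_apply_mem {R : Type*} [CommRing R] {I : Ideal R} {x : ArrowPairs π → R}
    (hx : ∀ q, x q ∈ I) (a : Q.DArrow) (r c : ι) : arrowMat π x a r c ∈ I := by
  by_cases h : π r = Q.dtgt a ∧ π c = Q.dsrc a
  · simpa [arrowMat, h] using hx ⟨(a, r, c), h⟩
  · rw [arrowMat_apply_of_not π x a h]
    exact I.zero_mem

variable [Fintype ι]

/-- Exactness of the deformation complex of a representation of the preprojective algebra in its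
middle term: every first order deformation is infinitesimally trivial. -/
def IsRigidRep (s : ArrowPairs π → ℂ) : Prop :=
  LinearMap.ker (linMoment π s) ≤ LinearMap.range (intertwine π s s)

theorem mul_apply_mem {R : Type*} [CommRing R] {I J : Ideal R} {M N : Matrix ι ι R}
    (hM : ∀ r c, M r c ∈ I) (hN : ∀ r c, N r c ∈ J) (r c : ι) : (M * N) r c ∈ I * J := by
  rw [Matrix.mul_apply]
  exact Ideal.sum_mem _ fun k _ => Ideal.mul_mem_mul (hM r k) (hN k c)

theorem moment_apply_mem {R : Type*} [CommRing R] {I J : Ideal R}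
    {f g : Q.DArrow → Matrix ι ι R} (hf : ∀ a r c, f a r c ∈ I) (hg : ∀ a r c, g a r c ∈ J)
    (r c : ι) : moment f g r c ∈ I * J := by
  rw [moment, Matrix.sum_apply]
  exact Ideal.sum_mem _ fun a _ => Ideal.sub_mem _ (mul_apply_mem (hf _) (hg _) r c)
    (mul_apply_mem (hf _) (hg _) r c)

theorem intertwine_sub_left {R : Type*} [CommRing R] (x x' y : ArrowPairs π → R)
    (g : VertexPairs π → R) (q : ArrowPairs π) :
    intertwine π x y g q =
      intertwine π x' y g q + (arrowMat π (x - x') q.1.1 * vertexMat π g) q.1.2.1 q.1.2.2 := by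
  simp only [intertwine, LinearMap.coe_mk, AddHom.coe_mk, arrowRes, arrowMat_sub, sub_mul,
    Matrix.sub_apply]
  ring

variable [DecidableEq ι]

theorem intertwine_one {R : Type*} [CommRing R] (x y : ArrowPairs π → R) :
    intertwine π x y (vertexRes π 1) = x - y := by
  have h1 : vertexMat π (vertexRes π (1 : Matrix ι ι R)) = 1 :=
    vertexMat_vertexRes π fun r c h => Matrix.one_apply_ne fun hrc => h (congrArg π hrc)
  ext ⟨q, hq⟩
  simp [intertwine, arrowRes, h1, arrowMat, hq]

variable {B : Type*} [CommRing B] [Algebra ℂ B]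

/-- A rigid representation is isomorphic to arbitrarily high order to any deformation of it. -/
theorem IsRigidRep.exists_approximate {s : ArrowPairs π → ℂ} (hs : IsRigidRep π s)
    (hs0 : moment (arrowMat π s) (arrowMat π s) = 0) {x : ArrowPairs π → B}
    (hx : moment (arrowMat π x) (arrowMat π x) = 0) {m : Ideal B}
    (hxs : ∀ q, x q - algebraMap ℂ B (s q) ∈ m) (n : ℕ) :
    ∃ y : VertexPairs π → B, (∀ p, y p ∈ m) ∧
      ∀ q, intertwine π x (fun q => algebraMap ℂ B (s q)) (vertexRes π 1 - y) q ∈ m ^ (n + 1) := by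
  set sB : ArrowPairs π → B := fun q => algebraMap ℂ B (s q)
  obtain ⟨S, T, hST⟩ := exists_homotopy_of_ker_le_range _ _ hs
  classical
  have hα : intertwine π sB sB = extendScalarsPi B (intertwine π s s) :=
    linearMap_ext_algebraMap (k := ℂ) fun v => by
      rw [extendScalarsPi_apply]
      ext q
      simp only [intertwine, LinearMap.coe_mk, AddHom.coe_mk, arrowRes, Matrix.sub_apply, map_sub,
        sB, ← map_arrowMat, ← map_vertexMat, ← Matrix.map_mul, Matrix.map_apply]
  have hβ : linMoment π sB = extendScalarsPi B (linMoment π s) :=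
    linearMap_ext_algebraMap (k := ℂ) fun v => by
      rw [extendScalarsPi_apply]
      ext q
      have hh (w : ArrowPairs π → ℂ) : arrowMat π (fun q => algebraMap ℂ B (w q)) =
          fun a => (arrowMat π w a).map (algebraMap ℂ B) :=
        funext fun a => (map_arrowMat π _ w a).symm
      simp only [linMoment, LinearMap.coe_mk, AddHom.coe_mk, vertexRes, Matrix.add_apply, map_add,
        sB, hh, ← map_moment, Matrix.map_apply]
  have hhom (D : ArrowPairs π → B) :
      intertwine π sB sB (extendScalarsPi B S D) + extendScalarsPi B T (linMoment π sB D) = D := by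
    have : intertwine π sB sB ∘ₗ extendScalarsPi B S + extendScalarsPi B T ∘ₗ linMoment π sB =
        LinearMap.id := by
      refine linearMap_ext_algebraMap (k := ℂ) fun v => ?_
      rw [hα, hβ]
      simp only [LinearMap.add_apply, LinearMap.comp_apply, extendScalarsPi_apply]
      ext q
      simpa using congrArg (algebraMap ℂ B) (congrFun (LinearMap.congr_fun hST v) q)
    exact LinearMap.congr_fun this D
  have hsB0 : moment (arrowMat π sB) (arrowMat π sB) = 0 := by
    have hh : arrowMat π sB = fun a => (arrowMat π s a).map (algebraMap ℂ B) :=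
      funext fun a => (map_arrowMat π _ s a).symm
    rw [hh, ← map_moment, hs0]
    ext
    simp
  induction n with
  | zero =>
    refine ⟨0, fun _ => m.zero_mem, fun q => ?_⟩
    rw [sub_zero, intertwine_one, zero_add, pow_one]
    exact hxs q
  | succ n ih =>
    obtain ⟨y, hy, hyD⟩ := ih
    set D := intertwine π x sB (vertexRes π 1 - y) with hD
    have hβD (p) : linMoment π sB D p ∈ m ^ (n + 2) := by
      have h1 := moment_intertwine π x sB (vertexRes π 1 - y) hx hsB0
      rw [← hD] at h1
      have h2 : linMoment π sB D p =
          - moment (arrowMat π x - arrowMat π sB) (arrowMat π D) p.1.1 p.1.2 := by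
        have h3 := congrFun (congrFun h1 p.1.1) p.1.2
        rw [moment_sub_left]
        simp only [linMoment, LinearMap.coe_mk, AddHom.coe_mk, vertexRes, Matrix.add_apply,
          Matrix.zero_apply, Matrix.sub_apply] at h3 ⊢
        linear_combination h3
      rw [h2, pow_succ' m (n + 1)]
      refine Submodule.neg_mem _ (moment_apply_mem (fun a r c => ?_)
        (fun a r c => arrowMat_apply_mem π hyD a r c) _ _)
      rw [Pi.sub_apply, ← arrowMat_sub]
      exact arrowMat_apply_mem π hxs a r c
    set h := extendScalarsPi B S D with hh
    have hhm (p) : h p ∈ m ^ (n + 1) := Ideal.map_pi _ D hyD _ p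
    refine ⟨y + h, fun p => m.add_mem (hy p) (Ideal.pow_le_self n.succ_ne_zero (hhm p)),
      fun q => ?_⟩
    have h1 := congrFun (hhom D) q
    rw [← sub_sub, map_sub, Pi.sub_apply, ← hD, intertwine_sub_left π x sB sB h q]
    have h2 : D q - (intertwine π sB sB h q +
          (arrowMat π (x - sB) q.1.1 * vertexMat π h) q.1.2.1 q.1.2.2) =
        extendScalarsPi B T (linMoment π sB D) q -
          (arrowMat π (x - sB) q.1.1 * vertexMat π h) q.1.2.1 q.1.2.2 := by
      rw [Pi.add_apply] at h1
      linear_combination -h1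
    rw [h2]
    refine Ideal.sub_mem _ (Ideal.map_pi _ _ hβD _ q) ?_
    rw [pow_succ' m (n + 1)]
    exact mul_apply_mem (arrowMat_apply_mem π hxs _) (vertexMat_apply_mem π hhm) _ _

/-- A deformation of a rigid representation over a Noetherian base is trivial Zariski-locally. -/
theorem IsRigidRep.exists_intertwiner [IsNoetherianRing B] {s : ArrowPairs π → ℂ}
    (hs : IsRigidRep π s) (hs0 : moment (arrowMat π s) (arrowMat π s) = 0) {x : ArrowPairs π → B}
    (hx : moment (arrowMat π x) (arrowMat π x) = 0) (ε : B →ₐ[ℂ] ℂ) (hε : ∀ q, ε (x q) = s q) :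
    ∃ g : VertexPairs π → B, intertwine π x (fun q => algebraMap ℂ B (s q)) g = 0 ∧
      ε (vertexMat π g).det = 1 := by
  classical
  set m : Ideal B := RingHom.ker ε
  have hxs (q) : x q - algebraMap ℂ B (s q) ∈ m := by
    simp [m, RingHom.mem_ker, hε]
  obtain ⟨r, y, hr, hy, hry⟩ := exists_solution_of_approximate m
    (intertwine π x (fun q => algebraMap ℂ B (s q)))
    (intertwine π x (fun q => algebraMap ℂ B (s q)) (vertexRes π 1)) fun n => by
      obtain ⟨y, hy, hyn⟩ := hs.exists_approximate π hs0 hx hxs n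
      refine ⟨y, hy, fun q => Ideal.pow_le_pow_right n.le_succ ?_⟩
      rw [← map_sub]
      exact hyn q
  refine ⟨(1 - r) • vertexRes π 1 - y, by rw [map_sub, map_smul, hry, sub_self], ?_⟩
  rw [← AlgHom.coe_toRingHom, RingHom.map_det, RingHom.mapMatrix_apply, map_vertexMat]
  have h1 : vertexMat π (vertexRes π (1 : Matrix ι ι ℂ)) = 1 :=
    vertexMat_vertexRes π fun r c h => Matrix.one_apply_ne fun hrc => h (congrArg π hrc)
  refine Eq.trans ?_ (Matrix.det_one (n := ι) (R := ℂ))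
  rw [← h1]
  congr 2
  ext p
  have hr' : ε r = 0 := hr
  have hy' : ε (y p) = 0 := hy p
  simp [hr', hy', vertexRes, Matrix.one_apply, apply_ite ε]

end Deformation

end LooplessQuiver

/-- The adjugate of an intertwiner with nonzero determinant intertwines in the other direction. -/
theorem adjugate_mul_eq_mul_adjugate {ι B : Type*} [Fintype ι] [DecidableEq ι] [CommRing B]
    [IsDomain B] {G X Y : Matrix ι ι B} (hG : G.det ≠ 0) (h : X * G = G * Y) :
    G.adjugate * X = Y * G.adjugate := by
  have h1 : G.det • (G.adjugate * X) = G.det • (Y * G.adjugate) := calc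
    G.det • (G.adjugate * X) = G.adjugate * (X * (G * G.adjugate)) := by
      rw [Matrix.mul_adjugate]; simp
    _ = G.adjugate * G * (Y * G.adjugate) := by rw [← mul_assoc X, h]; simp only [mul_assoc]
    _ = G.det • (Y * G.adjugate) := by rw [Matrix.adjugate_mul]; simp
  ext r c
  exact mul_left_cancel₀ hG (congrFun (congrFun h1 r) c)

namespace LooplessQuiver

section RepresentationVariety

variable {Q : LooplessQuiver} {ι : Type} [Fintype ι] (π : ι → Q.V)

/-- The defining ideal of the variety of representations of the preprojective algebra with the
given vertex grading. -/
noncomputable def repIdeal : Ideal (MvPolynomial (ArrowPairs π) ℂ) :=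
  Ideal.span (Set.range fun rc : ι × ι =>
    moment (arrowMat π MvPolynomial.X) (arrowMat π MvPolynomial.X) rc.1 rc.2)

theorem repIdeal_le_ker {s : ArrowPairs π → ℂ}
    (hs : moment (arrowMat π s) (arrowMat π s) = 0) :
    repIdeal π ≤ RingHom.ker (MvPolynomial.aeval s : MvPolynomial (ArrowPairs π) ℂ →ₐ[ℂ] ℂ) := by
  refine Ideal.span_le.2 ?_
  rintro _ ⟨rc, rfl⟩
  have h := map_moment_arrowMat π
    (MvPolynomial.aeval s : MvPolynomial (ArrowPairs π) ℂ →ₐ[ℂ] ℂ).toRingHom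
    MvPolynomial.X rc.1 rc.2
  simpa [hs] using h

end RepresentationVariety

section Components

variable {Q : LooplessQuiver} {ι : Type} [DecidableEq ι] (π : ι → Q.V)

/-- The matrix of a vertex idempotent. -/
def idemMat (R : Type*) [Zero R] [One R] (i : Q.V) : Matrix ι ι R :=
  Matrix.diagonal fun r => if π r = i then 1 else 0

theorem map_idemMat {R S : Type*} [CommRing R] [CommRing S] (φ : R →+* S) (i : Q.V) :
    (idemMat π R i).map φ = idemMat π S i := by
  ext r c
  by_cases h : r = c <;> simp [idemMat, h, apply_ite φ]

variable [Fintype ι]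

theorem idemMat_mul_vertexMat {R : Type*} [CommRing R] (g : VertexPairs π → R) (i : Q.V) :
    idemMat π R i * vertexMat π g = vertexMat π g * idemMat π R i := by
  ext r c
  rw [idemMat, Matrix.diagonal_mul, Matrix.mul_diagonal]
  by_cases h : π r = π c
  · simp [h]
  · simp [vertexMat_apply_of_ne π g h]

/-- Two rigid representations on the same irreducible component are isomorphic. -/
theorem exists_iso_of_isRigidRep {p : Ideal (MvPolynomial (ArrowPairs π) ℂ)} [p.IsPrime]
    (hp : repIdeal π ≤ p) {s s' : ArrowPairs π → ℂ} (hs : IsRigidRep π s) (hs' : IsRigidRep π s')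
    (hs0 : moment (arrowMat π s) (arrowMat π s) = 0)
    (hs0' : moment (arrowMat π s') (arrowMat π s') = 0)
    (hps : p ≤ RingHom.ker (MvPolynomial.aeval s : MvPolynomial (ArrowPairs π) ℂ →ₐ[ℂ] ℂ))
    (hps' : p ≤ RingHom.ker (MvPolynomial.aeval s' : MvPolynomial (ArrowPairs π) ℂ →ₐ[ℂ] ℂ)) :
    ∃ g : Matrix ι ι ℂ, g.det ≠ 0 ∧ (∀ i, g * idemMat π ℂ i = idemMat π ℂ i * g) ∧
      ∀ a, g * arrowMat π s a = arrowMat π s' a * g := by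
  set B := MvPolynomial (ArrowPairs π) ℂ ⧸ p
  set x : ArrowPairs π → B := fun q => Ideal.Quotient.mk p (MvPolynomial.X q)
  have hx : moment (arrowMat π x) (arrowMat π x) = 0 := by
    ext r c
    rw [← map_moment_arrowMat, Matrix.zero_apply, Ideal.Quotient.eq_zero_iff_mem]
    exact hp (Ideal.subset_span ⟨(r, c), rfl⟩)
  have key {t : ArrowPairs π → ℂ} (ht : IsRigidRep π t)
      (ht0 : moment (arrowMat π t) (arrowMat π t) = 0)
      (hpt : p ≤ RingHom.ker (MvPolynomial.aeval t : MvPolynomial (ArrowPairs π) ℂ →ₐ[ℂ] ℂ)) :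
      ∃ G : Matrix ι ι B, G.det ≠ 0 ∧ (∀ i, idemMat π B i * G = G * idemMat π B i) ∧
        ∀ a, arrowMat π x a * G = G * arrowMat π (fun q => algebraMap ℂ B (t q)) a := by
    obtain ⟨g, hg, hdet⟩ := ht.exists_intertwiner π ht0 hx
      (Ideal.Quotient.liftₐ p (MvPolynomial.aeval t) hpt) fun q => by
        exact MvPolynomial.aeval_X t q
    refine ⟨vertexMat π g, fun h => by simp [h] at hdet, idemMat_mul_vertexMat π g, fun a => ?_⟩
    have h := arrowMat_intertwine π x (fun q => algebraMap ℂ B (t q)) g a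
    rw [hg] at h
    rw [← sub_eq_zero, ← h]
    ext r c
    simp [arrowMat]
  obtain ⟨G, hG, hGe, hGx⟩ := key hs hs0 hps
  obtain ⟨G', hG', hGe', hGx'⟩ := key hs' hs0' hps'
  obtain ⟨f, hf⟩ := Ideal.Quotient.mk_surjective (G'.adjugate * G).det
  have hfp : f ∉ p := by
    rw [← Ideal.Quotient.eq_zero_iff_mem, hf, Matrix.det_mul, Matrix.det_adjugate]
    exact mul_ne_zero (pow_ne_zero _ hG') hG
  obtain ⟨z, hz, hzf⟩ : ∃ z ∈ MvPolynomial.zeroLocus ℂ p, MvPolynomial.aeval z f ≠ 0 := by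
    by_contra! hcon
    exact hfp (MvPolynomial.IsPrime.vanishingIdeal_zeroLocus (K := ℂ) p ▸ hcon)
  set φ : B →ₐ[ℂ] ℂ := Ideal.Quotient.liftₐ p (MvPolynomial.aeval z) hz
  have hφ (t : ArrowPairs π → ℂ) (a : Q.DArrow) :
      (arrowMat π (fun q => algebraMap ℂ B (t q)) a).map φ = arrowMat π t a := by
    rw [← AlgHom.coe_toRingHom, map_arrowMat]
    simp
  have hφe (i : Q.V) : (idemMat π B i).map φ = idemMat π ℂ i := by
    rw [← AlgHom.coe_toRingHom, map_idemMat]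
  have hmul (M N : Matrix ι ι B) : (M * N).map φ = M.map φ * N.map φ := Matrix.map_mul
  refine ⟨(G'.adjugate * G).map φ, ?_, fun i => ?_, fun a => ?_⟩
  · have h1 : φ (G'.adjugate * G).det = MvPolynomial.aeval z f := by
      rw [← hf]
      exact Ideal.Quotient.liftₐ_apply p _ hz _
    rw [← h1] at hzf
    rwa [← AlgHom.mapMatrix_apply, ← AlgHom.map_det]
  · rw [← hφe, ← hmul, ← hmul, mul_assoc, ← hGe, ← mul_assoc, ← mul_assoc,
      adjugate_mul_eq_mul_adjugate hG' (hGe' i)]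
  · rw [← hφ, ← hφ, ← hmul, ← hmul, mul_assoc, ← hGx, ← mul_assoc, ← mul_assoc,
      adjugate_mul_eq_mul_adjugate hG' (hGx' a)]

end Components

end LooplessQuiver

namespace LooplessQuiver

section Dimension

variable {Q : LooplessQuiver} {ι : Type} [Fintype ι] (π : ι → Q.V)

/-- The dimension vector of a vertex grading. -/
def fiberCard (i : Q.V) : ℕ := Fintype.card {r // π r = i}

theorem card_vertexPairs :
    Fintype.card (VertexPairs π) = ∑ i, fiberCard π i * fiberCard π i := by
  let e : VertexPairs π ≃ Σ i, {r // π r = i} × {r // π r = i} :=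
    { toFun := fun p => ⟨π p.1.2, ⟨p.1.1, p.2⟩, ⟨p.1.2, rfl⟩⟩
      invFun := fun q => ⟨(q.2.1, q.2.2), q.2.1.2.trans q.2.2.2.symm⟩
      left_inv := fun _ => rfl
      right_inv := by rintro ⟨_, ⟨r, hr⟩, ⟨c, rfl⟩⟩; rfl }
  simp [Fintype.card_congr e, fiberCard]

theorem card_arrowPairs :
    Fintype.card (ArrowPairs π) =
      ∑ a : Q.DArrow, fiberCard π (Q.dtgt a) * fiberCard π (Q.dsrc a) := by
  let e : ArrowPairs π ≃ Σ a : Q.DArrow, {r // π r = Q.dtgt a} × {r // π r = Q.dsrc a} :=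
    { toFun := fun q => ⟨q.1.1, ⟨q.1.2.1, q.2.1⟩, ⟨q.1.2.2, q.2.2⟩⟩
      invFun := fun q => ⟨(q.1, q.2.1, q.2.2), q.2.1.2, q.2.2.2⟩
      left_inv := fun _ => rfl
      right_inv := fun _ => rfl }
  simp [Fintype.card_congr e, fiberCard]

theorem form_fiberCard :
    Q.form (fun i => fiberCard π i) (fun i => fiberCard π i) =
      2 * (Fintype.card (VertexPairs π) : ℤ) - Fintype.card (ArrowPairs π) := by
  rw [card_vertexPairs, card_arrowPairs, form]
  push_cast
  rw [Fintype.sum_sum_type, Finset.sum_add_distrib]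
  simp only [dsrc, dtgt]
  ring

theorem range_intertwine_le_ker {s : ArrowPairs π → ℂ}
    (hs0 : moment (arrowMat π s) (arrowMat π s) = 0) :
    LinearMap.range (intertwine π s s) ≤ LinearMap.ker (linMoment π s) := by
  rintro _ ⟨g, rfl⟩
  exact linMoment_comp_intertwine π s g hs0

open scoped ComplexOrder in
theorem intertwine_eq_zero_of_trace (s : ArrowPairs π → ℂ) (g : VertexPairs π → ℂ)
    (h : ∀ f, (vertexMat π (linMoment π s f) * vertexMat π g).trace = 0) :
    intertwine π s s g = 0 := by
  set C := arrowMat π (intertwine π s s g) with hC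
  let F : Q.DArrow → Matrix ι ι ℂ
    | .inl a => (C (.inr a)).conjTranspose
    | .inr a => -(C (.inl a)).conjTranspose
  have hF : arrowMat π (arrowRes π F) = F := by
    refine arrowMat_arrowRes π fun a r c hrc => ?_
    rcases a with a | a
    · simp only [F, Matrix.conjTranspose_apply]
      rw [hC, arrowMat_apply_of_not π _ _ fun h' => hrc h'.symm, star_zero]
    · simp only [F, Matrix.conjTranspose_apply, Matrix.neg_apply]
      rw [hC, arrowMat_apply_of_not π _ _ fun h' => hrc h'.symm, star_zero, neg_zero]
  have h1 := h (arrowRes π F)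
  rw [vertexMat_linMoment, hF] at h1
  have hCa (a) : C a = arrowMat π s a * vertexMat π g - vertexMat π g * arrowMat π s a :=
    arrowMat_intertwine π s s g a
  have h2 : ∑ a : Q.A, (((C (.inl a)).conjTranspose * C (.inl a)).trace +
      ((C (.inr a)).conjTranspose * C (.inr a)).trace) = 0 := by
    rw [← h1, moment, moment, ← Finset.sum_add_distrib, Finset.sum_mul, Matrix.trace_sum]
    refine Finset.sum_congr rfl fun a _ => ?_
    have e1 : F (.inl a) = (C (.inr a)).conjTranspose := rfl
    have e2 : F (.inr a) = -(C (.inl a)).conjTranspose := rfl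
    rw [e1, e2]
    generalize (C (.inr a)).conjTranspose = P
    generalize (C (.inl a)).conjTranspose = P'
    rw [hCa, hCa]
    generalize vertexMat π g = G
    generalize arrowMat π s (.inl a) = X
    generalize arrowMat π s (.inr a) = Y
    simp only [add_mul, sub_mul, mul_sub, Matrix.trace_add, Matrix.trace_sub, mul_neg, neg_mul,
      Matrix.trace_neg, ← mul_assoc]
    rw [Matrix.trace_mul_cycle X P' G, Matrix.trace_mul_cycle Y P G, Matrix.trace_mul_cycle G X P',
      Matrix.trace_mul_cycle G Y P]
    ring
  have hnn (a : Q.DArrow) : 0 ≤ ((C a).conjTranspose * C a).trace :=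
    (Matrix.posSemidef_conjTranspose_mul_self _).trace_nonneg
  rw [Finset.sum_eq_zero_iff_of_nonneg fun a _ => add_nonneg (hnn _) (hnn _)] at h2
  have h3 (a : Q.DArrow) : C a = 0 := by
    rw [← Matrix.trace_conjTranspose_mul_self_eq_zero_iff]
    rcases a with a | a
    · exact ((add_eq_zero_iff_of_nonneg (hnn _) (hnn _)).1 (h2 a (Finset.mem_univ a))).1
    · exact ((add_eq_zero_iff_of_nonneg (hnn _) (hnn _)).1 (h2 a (Finset.mem_univ a))).2
  rw [← arrowRes_arrowMat π (intertwine π s s g), ← hC, funext h3]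
  rfl

variable [DecidableEq ι]

theorem finrank_ker_intertwine_le {s : ArrowPairs π → ℂ}
    (hs : ∀ g, intertwine π s s g = 0 → ∃ t : ℂ, g = t • vertexRes π 1) :
    Module.finrank ℂ (LinearMap.ker (intertwine π s s)) ≤ 1 := by
  have h1 : LinearMap.ker (intertwine π s s) ≤ Submodule.span ℂ {vertexRes π (1 : Matrix ι ι ℂ)} :=
    fun g hg => by
      obtain ⟨t, rfl⟩ := hs g hg
      exact Submodule.mem_span_singleton.2 ⟨t, rfl⟩
  exact (Submodule.finrank_mono h1).trans ((finrank_span_le_card _).trans (by simp))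

theorem card_vertexPairs_le_finrank_range_linMoment {s : ArrowPairs π → ℂ}
    (hs : ∀ g, intertwine π s s g = 0 → ∃ t : ℂ, g = t • vertexRes π 1) :
    Fintype.card (VertexPairs π) ≤ Module.finrank ℂ (LinearMap.range (linMoment π s)) + 1 := by
  let τ : (VertexPairs π → ℂ) →ₗ[ℂ] Module.Dual ℂ (VertexPairs π → ℂ) :=
    LinearMap.mk₂ ℂ (fun g f => (vertexMat π f * vertexMat π g).trace)
      (fun g g' f => by simp [vertexMat_add, mul_add])
      (fun t g f => by simp [vertexMat_smul])
      (fun g f f' => by simp [vertexMat_add, add_mul])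
      (fun t g f => by simp [vertexMat_smul])
  set Ψ := (linMoment π s).dualMap ∘ₗ τ
  have hker : LinearMap.ker Ψ ≤ LinearMap.ker (intertwine π s s) := fun g hg =>
    intertwine_eq_zero_of_trace π s g fun f => LinearMap.congr_fun hg f
  have h1 := Ψ.finrank_range_add_finrank_ker
  have h2 := (Submodule.finrank_mono hker).trans (finrank_ker_intertwine_le π hs)
  have h3 : Module.finrank ℂ (LinearMap.range Ψ) ≤ _ :=
    Submodule.finrank_mono (LinearMap.range_comp_le_range τ (linMoment π s).dualMap)
  rw [LinearMap.finrank_range_dualMap_eq_finrank_range] at h3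
  rw [Module.finrank_fintype_fun_eq_card] at h1
  omega

theorem form_fiberCard_le_two {s : ArrowPairs π → ℂ}
    (hs0 : moment (arrowMat π s) (arrowMat π s) = 0)
    (hs : ∀ g, intertwine π s s g = 0 → ∃ t : ℂ, g = t • vertexRes π 1) :
    Q.form (fun i => fiberCard π i) (fun i => fiberCard π i) ≤ 2 := by
  have h1 := (intertwine π s s).finrank_range_add_finrank_ker
  have h2 := (linMoment π s).finrank_range_add_finrank_ker
  have h3 := Submodule.finrank_mono (range_intertwine_le_ker π hs0)
  have h4 := card_vertexPairs_le_finrank_range_linMoment π hs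
  have h5 := finrank_ker_intertwine_le π hs
  rw [Module.finrank_fintype_fun_eq_card] at h1 h2
  rw [form_fiberCard]
  omega

theorem two_dvd_form_self (v : Q.V → ℤ) : 2 ∣ Q.form v v := by
  refine ⟨∑ i, v i * v i - ∑ a, v (Q.src a) * v (Q.tgt a), ?_⟩
  rw [form, mul_sub, Finset.mul_sum Finset.univ (fun a => v (Q.src a) * v (Q.tgt a))]
  congr 1
  exact Finset.sum_congr rfl fun a _ => by ring

theorem isRigidRep_of_scalar_endomorphisms [Nonempty ι] (hQ : Q.IsDynkin) {s : ArrowPairs π → ℂ}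
    (hs0 : moment (arrowMat π s) (arrowMat π s) = 0)
    (hs : ∀ g, intertwine π s s g = 0 → ∃ t : ℂ, g = t • vertexRes π 1) :
    IsRigidRep π s := by
  have hpos : 2 ≤ Q.form (fun i => fiberCard π i) (fun i => fiberCard π i) := by
    obtain ⟨r⟩ := ‹Nonempty ι›
    have h0 : (fun i => (fiberCard π i : ℤ)) ≠ 0 := fun h => by
      have h1 : (fiberCard π (π r) : ℤ) = 0 := congrFun h (π r)
      have : Nonempty {r' // π r' = π r} := ⟨⟨r, rfl⟩⟩
      exact Fintype.card_ne_zero (by exact_mod_cast h1 : Fintype.card {r' // π r' = π r} = 0)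
    exact Int.le_of_dvd (hQ _ h0) (two_dvd_form_self _)
  have h1 := (intertwine π s s).finrank_range_add_finrank_ker
  have h2 := (linMoment π s).finrank_range_add_finrank_ker
  have h4 := card_vertexPairs_le_finrank_range_linMoment π hs
  have h5 := finrank_ker_intertwine_le π hs
  rw [Module.finrank_fintype_fun_eq_card] at h1 h2
  rw [form_fiberCard] at hpos
  exact (Submodule.eq_of_le_of_finrank_le (range_intertwine_le_ker π hs0) (by omega)).ge

end Dimension

section PositiveDefinite

variable {Q : LooplessQuiver}

theorem form_sub_smul (v w : Q.V → ℤ) (s t : ℤ) :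
    Q.form (s • v - t • w) (s • v - t • w) =
      s ^ 2 * Q.form v v - 2 * s * t * Q.form v w + t ^ 2 * Q.form w w := by
  simp only [form, Pi.sub_apply, Pi.smul_apply, smul_eq_mul, mul_sub, Finset.mul_sum]
  have (a b c d e f g h: ℤ) (h1 : a = c - e + g) (h2 : b = d - f + h) :
      a - b = c - d - (e - f) + (g - h) := by rw [h1, h2]; ring
  apply this
  · rw [← Finset.sum_sub_distrib, ← Finset.sum_add_distrib]
    exact Finset.sum_congr rfl fun _ _ => by ring
  · rw [← Finset.sum_sub_distrib, ← Finset.sum_add_distrib]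
    exact Finset.sum_congr rfl fun _ _ => by ring

/-- The Cauchy-Schwarz inequality for the form of a Dynkin quiver. -/
theorem IsDynkin.form_sq_le (hQ : Q.IsDynkin) (v w : Q.V → ℤ) :
    Q.form v w ^ 2 ≤ Q.form v v * Q.form w w := by
  by_cases hw : w = 0
  · simp [hw, form]
  · have hpos := hQ w hw
    have hnn : 0 ≤ Q.form (Q.form w w • v - Q.form v w • w) (Q.form w w • v - Q.form v w • w) := by
      by_cases h : Q.form w w • v - Q.form v w • w = 0
      · rw [h]; simp [form]
      · exact (hQ _ h).le
    rw [form_sub_smul] at hnn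
    nlinarith

/-- The Gram matrix of the form of a quiver. -/
def gram (Q : LooplessQuiver) : Matrix Q.V Q.V ℤ :=
  (2 : ℤ) • 1 - ∑ a, (Matrix.single (Q.src a) (Q.tgt a) 1 + Matrix.single (Q.tgt a) (Q.src a) 1)

theorem dotProduct_gram_mulVec (v w : Q.V → ℤ) : v ⬝ᵥ Q.gram.mulVec w = Q.form v w := by
  rw [gram, Matrix.sub_mulVec, Matrix.sum_mulVec, dotProduct_sub, dotProduct_sum, form,
    Matrix.smul_mulVec, dotProduct_smul, Matrix.one_mulVec, smul_eq_mul]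
  congr 1
  refine Finset.sum_congr rfl fun a _ => ?_
  rw [Matrix.add_mulVec, dotProduct_add, Matrix.single_mulVec, Matrix.single_mulVec]
  simp [dotProduct, Function.update_apply]

theorem IsDynkin.det_gram_ne_zero (hQ : Q.IsDynkin) : Q.gram.det ≠ 0 := fun h => by
  obtain ⟨v, hv, hv0⟩ := Matrix.exists_mulVec_eq_zero_iff.2 h
  have := hQ v hv
  rw [← dotProduct_gram_mulVec, hv0, dotProduct_zero] at this
  exact this.false

/-- A Dynkin quiver has only finitely many roots. -/
theorem IsDynkin.finite_roots (hQ : Q.IsDynkin) :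
    {d : Q.V → ℕ | Q.form (fun i => d i) (fun i => d i) ≤ 2}.Finite := by
  let u (i : Q.V) : Q.V → ℤ := fun j => Q.gram.adjugate i j
  let N : Q.V → ℕ := fun i => (2 * Q.form (u i) (u i)).toNat
  refine (Set.finite_Iic N).subset fun d hd i => ?_
  have h1 : Q.form (u i) (fun j => d j) = Q.gram.det * d i := by
    rw [← dotProduct_gram_mulVec]
    have h2 : Q.gram.adjugate.mulVec (Q.gram.mulVec fun j => (d j : ℤ)) i = Q.gram.det * d i := by
      rw [Matrix.mulVec_mulVec, Matrix.adjugate_mul]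
      simp
    exact h2
  have h2 := hQ.form_sq_le (u i) (fun j => (d j : ℤ))
  have hu : 0 ≤ Q.form (u i) (u i) := by
    by_cases h : u i = 0
    · rw [h]; simp [form]
    · exact (hQ _ h).le
  have h3 : 1 ≤ Q.gram.det ^ 2 := by
    have := sq_pos_of_ne_zero hQ.det_gram_ne_zero
    omega
  have h4 : (d i : ℤ) ≤ (d i : ℤ) ^ 2 := by
    exact_mod_cast Nat.le_self_pow two_ne_zero (d i)
  have hd' : Q.form (fun j => (d j : ℤ)) (fun j => (d j : ℤ)) ≤ 2 := hd
  rw [h1, mul_pow] at h2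
  have h5 : (d i : ℤ) ≤ 2 * Q.form (u i) (u i) := by nlinarith
  change d i ≤ (2 * Q.form (u i) (u i)).toNat
  omega

end PositiveDefinite

end LooplessQuiver

namespace LooplessQuiver

section Matrices

variable {Q : LooplessQuiver} {ι : Type} [Fintype ι] [DecidableEq ι]

theorem pe_mul_pe (i j : Q.V) : Q.pe i * Q.pe j = if i = j then Q.pe i else 0 := by
  have h := RingQuot.mkAlgHom_rel ℂ (Rel.vertex_mul (Q := Q) i j)
  rw [map_mul, apply_ite (RingQuot.mkAlgHom ℂ Q.Rel), map_zero] at h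
  exact h

theorem sum_pe : ∑ i, Q.pe i = 1 := by
  have h := RingQuot.mkAlgHom_rel ℂ (Rel.vertex_sum (Q := Q))
  rw [map_sum, map_one] at h
  exact h

theorem pe_mul_px (a : Q.DArrow) : Q.pe (Q.dtgt a) * Q.px a = Q.px a := by
  have h := RingQuot.mkAlgHom_rel ℂ (Rel.arrow_left (Q := Q) a)
  rw [map_mul] at h
  exact h

theorem px_mul_pe (a : Q.DArrow) : Q.px a * Q.pe (Q.dsrc a) = Q.px a := by
  have h := RingQuot.mkAlgHom_rel ℂ (Rel.arrow_right (Q := Q) a)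
  rw [map_mul] at h
  exact h

theorem sum_px_mul_px :
    ∑ a : Q.A, (Q.px (.inl a) * Q.px (.inr a) - Q.px (.inr a) * Q.px (.inl a)) = 0 := by
  have h := RingQuot.mkAlgHom_rel ℂ (Rel.preprojective (Q := Q))
  simp only [map_sum, map_sub, map_mul, map_zero] at h
  exact h

theorem semiconj_of_generators (ρ ρ' : Q.Preproj →ₐ[ℂ] Matrix ι ι ℂ) (g : Matrix ι ι ℂ)
    (he : ∀ i, g * ρ (Q.pe i) = ρ' (Q.pe i) * g) (hx : ∀ a, g * ρ (Q.px a) = ρ' (Q.px a) * g)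
    (y : Q.Preproj) : g * ρ y = ρ' y * g := by
  obtain ⟨w, rfl⟩ := RingQuot.mkAlgHom_surjective ℂ Q.Rel y
  induction w using FreeAlgebra.induction with
  | grade0 t => simp only [AlgHom.commutes, Algebra.commutes]
  | grade1 z =>
    rcases z with i | a
    · exact he i
    · exact hx a
  | mul v w hv hw => rw [map_mul, map_mul, map_mul, ← mul_assoc, hv, mul_assoc, hw, mul_assoc]
  | add v w hv hw => rw [map_add, map_add, map_add, mul_add, hv, hw, add_mul]

/-- The entries of the arrows in a matrix representation of the preprojective algebra. -/
noncomputable def arrowEntries (π : ι → Q.V) (ρ : Q.Preproj →ₐ[ℂ] Matrix ι ι ℂ) :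
    ArrowPairs π → ℂ := arrowRes π fun a => ρ (Q.px a)

variable {π : ι → Q.V} {ρ : Q.Preproj →ₐ[ℂ] Matrix ι ι ℂ}

theorem arrowMat_arrowEntries (hρ : ∀ i, ρ (Q.pe i) = idemMat π ℂ i) (a : Q.DArrow) :
    arrowMat π (arrowEntries π ρ) a = ρ (Q.px a) := by
  refine congrFun (arrowMat_arrowRes π (f := fun a => ρ (Q.px a)) fun a r c h => ?_) a
  have h1 := congrFun (congrFun (congrArg ρ (pe_mul_px a)) r) c
  have h2 := congrFun (congrFun (congrArg ρ (px_mul_pe a)) r) c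
  rw [map_mul, hρ, idemMat, Matrix.diagonal_mul] at h1
  rw [map_mul, hρ, idemMat, Matrix.mul_diagonal] at h2
  by_cases hr : π r = Q.dtgt a
  · rw [← h2, if_neg fun hc => h ⟨hr, hc⟩, mul_zero]
  · rw [← h1, if_neg hr, zero_mul]

theorem moment_arrowEntries (hρ : ∀ i, ρ (Q.pe i) = idemMat π ℂ i) :
    moment (arrowMat π (arrowEntries π ρ)) (arrowMat π (arrowEntries π ρ)) = 0 := by
  have h := congrArg ρ (sum_px_mul_px (Q := Q))
  simp only [map_sum, map_sub, map_mul, map_zero, ← arrowMat_arrowEntries hρ] at h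
  exact h

theorem scalar_of_intertwine_eq_zero (hρ : ∀ i, ρ (Q.pe i) = idemMat π ℂ i)
    (hs : ∀ g, (∀ y, g * ρ y = ρ y * g) → ∃ t : ℂ, g = t • 1) (g : VertexPairs π → ℂ)
    (hg : intertwine π (arrowEntries π ρ) (arrowEntries π ρ) g = 0) :
    ∃ t : ℂ, g = t • vertexRes π 1 := by
  obtain ⟨t, ht⟩ := hs (vertexMat π g) <| semiconj_of_generators ρ ρ _
    (fun i => by rw [hρ, idemMat_mul_vertexMat]) fun a => by
      have h := arrowMat_intertwine π (arrowEntries π ρ) (arrowEntries π ρ) g a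
      rw [hg, arrowMat_arrowEntries hρ] at h
      refine (sub_eq_zero.1 (h.symm.trans ?_)).symm
      ext r c
      simp [arrowMat]
  exact ⟨t, by rw [← vertexRes_vertexMat π g, ht]; rfl⟩

end Matrices

section Modules

variable {Q : LooplessQuiver} {M N : Type*} [AddCommGroup M] [Module ℂ M] [Module Q.Preproj M]
  [IsScalarTower ℂ Q.Preproj M] [AddCommGroup N] [Module ℂ N] [Module Q.Preproj N]
  [IsScalarTower ℂ Q.Preproj N] {ι : Type} [Fintype ι] [DecidableEq ι]

/-- The matrix representation of the preprojective algebra attached to a basis of a module. -/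
noncomputable def matrixRep (b : Module.Basis ι ℂ M) : Q.Preproj →ₐ[ℂ] Matrix ι ι ℂ :=
  (LinearMap.toMatrixAlgEquiv b).toAlgHom.comp (Algebra.lsmul ℂ ℂ M)

theorem matrixRep_apply (b : Module.Basis ι ℂ M) (y : Q.Preproj) :
    matrixRep b y = LinearMap.toMatrix b b (Algebra.lsmul ℂ ℂ M y) := rfl

theorem matrixRep_apply_apply (b : Module.Basis ι ℂ M) (y : Q.Preproj) (r c : ι) :
    matrixRep b y r c = b.repr (y • b c) r := by
  rw [matrixRep_apply, LinearMap.toMatrix_apply]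
  rfl

theorem toLin_smul (b : Module.Basis ι ℂ M) (c : Module.Basis ι ℂ N) {g : Matrix ι ι ℂ}
    (hg : ∀ y : Q.Preproj, g * matrixRep b y = matrixRep c y * g) (y : Q.Preproj) (m : M) :
    Matrix.toLin b c g (y • m) = y • Matrix.toLin b c g m := by
  have h := congrArg (Matrix.toLin b c) (hg y)
  rw [Matrix.toLin_mul b b c, Matrix.toLin_mul b c c, matrixRep_apply, matrixRep_apply,
    Matrix.toLin_toMatrix, Matrix.toLin_toMatrix] at h
  exact LinearMap.congr_fun h m

theorem nonempty_linearEquiv_of_matrixRep (b : Module.Basis ι ℂ M) (c : Module.Basis ι ℂ N)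
    {g : Matrix ι ι ℂ} (hdet : g.det ≠ 0)
    (hg : ∀ y : Q.Preproj, g * matrixRep b y = matrixRep c y * g) :
    Nonempty (M ≃ₗ[Q.Preproj] N) := by
  have hu : IsUnit g.det := hdet.isUnit
  let e := Matrix.toLinOfInv b c (Matrix.mul_nonsing_inv g hu) (Matrix.nonsing_inv_mul g hu)
  exact ⟨{ e with map_smul' := toLin_smul b c hg }⟩

theorem exists_basis_matrixRep_pe [FiniteDimensional ℂ M] :
    ∃ (d : Q.V → ℕ) (b : Module.Basis (Σ i, Fin (d i)) ℂ M),
      ∀ i, matrixRep b (Q.pe i) = idemMat Sigma.fst ℂ i := by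
  let E (i : Q.V) : M →ₗ[ℂ] M := Algebra.lsmul ℂ ℂ M (Q.pe i)
  have hE (i j : Q.V) (m : M) : Q.pe i • Q.pe j • m = if i = j then Q.pe i • m else 0 := by
    rw [← mul_smul, pe_mul_pe]
    split_ifs
    · rfl
    · rw [zero_smul]
  have hmem {i j : Q.V} {m : M} (hm : m ∈ LinearMap.range (E j)) :
      Q.pe i • m = if i = j then m else 0 := by
    obtain ⟨m, rfl⟩ := hm
    refine (hE i j m).trans ?_
    split_ifs with h
    · rw [h]; rfl
    · rfl
  have hint : DirectSum.IsInternal fun i => LinearMap.range (E i) := by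
    refine (DirectSum.isInternal_submodule_iff_iSupIndep_and_iSup_eq_top _).2 ⟨?_, ?_⟩
    · intro i
      have hle : ⨆ j, ⨆ (_ : j ≠ i), LinearMap.range (E j) ≤ LinearMap.ker (E i) :=
        iSup₂_le fun j hj m hm => (hmem hm).trans (if_neg hj.symm)
      refine Submodule.disjoint_def.2 fun m hm hm' => ?_
      exact ((hmem hm).trans (if_pos rfl)).symm.trans (hle hm')
    · refine eq_top_iff.2 fun m _ => ?_
      have : m = ∑ i, E i m := by
        change m = ∑ i, Q.pe i • m
        rw [← Finset.sum_smul, sum_pe, one_smul]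
      rw [this]
      exact Submodule.sum_mem _ fun i _ =>
        Submodule.mem_iSup_of_mem i (LinearMap.mem_range_self _ m)
  let b := hint.collectedBasis fun i => Module.finBasis ℂ (LinearMap.range (E i))
  refine ⟨_, b, fun i => ?_⟩
  ext r c
  rw [matrixRep_apply_apply, hmem (hint.collectedBasis_mem _ c), idemMat, Matrix.diagonal_apply]
  by_cases h : i = c.1
  · rw [if_pos h, Module.Basis.repr_self, Finsupp.single_apply]
    by_cases hrc : r = c
    · simp [hrc, h]
    · simp [hrc, Ne.symm hrc]
  · rw [if_neg h]
    by_cases hrc : r = c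
    · simp [hrc, Ne.symm h]
    · simp [hrc]

end Modules

end LooplessQuiver

namespace LooplessQuiver

section Components

variable {Q : LooplessQuiver} {M : Type*} [AddCommGroup M] [Module ℂ M] [Module Q.Preproj M]
  [IsScalarTower ℂ Q.Preproj M] {ι : Type} [Fintype ι] [DecidableEq ι] {π : ι → Q.V}
  {b : Module.Basis ι ℂ M}

theorem intertwine_matrixRep_scalar (hb : ∀ i, matrixRep b (Q.pe i) = idemMat π ℂ i)
    (hM : ∀ f : M →ₗ[Q.Preproj] M, ∃ t : ℂ, ∀ m, f m = t • m) (g : VertexPairs π → ℂ)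
    (hg : intertwine π (arrowEntries π (matrixRep b)) (arrowEntries π (matrixRep b)) g = 0) :
    ∃ t : ℂ, g = t • vertexRes π 1 := by
  refine scalar_of_intertwine_eq_zero hb (fun G hG => ?_) g hg
  obtain ⟨t, ht⟩ := hM { Matrix.toLin b b G with map_smul' := toLin_smul b b hG }
  refine ⟨t, (Matrix.toLin b b).injective (LinearMap.ext fun m => ?_)⟩
  rw [map_smul, Matrix.toLin_one]
  exact ht m

variable (M) in
/-- The module `M` has dimension vector `d`, and in a suitable basis it is a rigid point of the
closed subset cut out by `p` of the variety of representations with dimension vector `d`. -/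
def IsRigidPointOn (d : Q.V → ℕ)
    (p : Ideal (MvPolynomial (ArrowPairs (Sigma.fst : (Σ i, Fin (d i)) → Q.V)) ℂ)) : Prop :=
  ∃ b : Module.Basis (Σ i, Fin (d i)) ℂ M,
    (∀ i, matrixRep b (Q.pe i) = idemMat Sigma.fst ℂ i) ∧
    IsRigidRep Sigma.fst (arrowEntries Sigma.fst (matrixRep b)) ∧
    p ≤ RingHom.ker (MvPolynomial.aeval (arrowEntries Sigma.fst (matrixRep b)) :
      MvPolynomial (ArrowPairs (Sigma.fst : (Σ i, Fin (d i)) → Q.V)) ℂ →ₐ[ℂ] ℂ)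

theorem exists_isRigidPointOn [FiniteDimensional ℂ M] [Nontrivial M] (hQ : Q.IsDynkin)
    (hM : ∀ f : M →ₗ[Q.Preproj] M, ∃ t : ℂ, ∀ m, f m = t • m) :
    ∃ d : Q.V → ℕ, Q.form (fun i => d i) (fun i => d i) ≤ 2 ∧
      ∃ p ∈ (repIdeal (Sigma.fst : (Σ i, Fin (d i)) → Q.V)).minimalPrimes,
        IsRigidPointOn M d p := by
  obtain ⟨d, b, hb⟩ := exists_basis_matrixRep_pe (Q := Q) (M := M)
  have hs := intertwine_matrixRep_scalar hb hM
  have hs0 := moment_arrowEntries hb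
  have : Nonempty (Σ i, Fin (d i)) := b.index_nonempty
  have hform := form_fiberCard_le_two Sigma.fst hs0 hs
  have hcard (i : Q.V) : fiberCard (Sigma.fst : (Σ i, Fin (d i)) → Q.V) i = d i := by
    rw [fiberCard, Fintype.card_congr (Equiv.sigmaSubtype i), Fintype.card_fin]
  simp only [hcard] at hform
  have := RingHom.ker_isPrime (MvPolynomial.aeval (arrowEntries Sigma.fst (matrixRep b)) :
    MvPolynomial (ArrowPairs (Sigma.fst : (Σ i, Fin (d i)) → Q.V)) ℂ →ₐ[ℂ] ℂ)
  obtain ⟨p, hp, hle⟩ := Ideal.exists_minimalPrimes_le (repIdeal_le_ker Sigma.fst hs0)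
  exact ⟨d, hform, p, hp, b, hb, isRigidRep_of_scalar_endomorphisms _ hQ hs0 hs, hle⟩

theorem IsRigidPointOn.nonempty_linearEquiv {N : Type*} [AddCommGroup N] [Module ℂ N]
    [Module Q.Preproj N] [IsScalarTower ℂ Q.Preproj N] {d : Q.V → ℕ}
    {p : Ideal (MvPolynomial (ArrowPairs (Sigma.fst : (Σ i, Fin (d i)) → Q.V)) ℂ)}
    (hp : p ∈ (repIdeal (Sigma.fst : (Σ i, Fin (d i)) → Q.V)).minimalPrimes)
    (hM : IsRigidPointOn M d p) (hN : IsRigidPointOn N d p) : Nonempty (M ≃ₗ[Q.Preproj] N) := by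
  obtain ⟨b, hb, hs, hps⟩ := hM
  obtain ⟨c, hc, hs', hps'⟩ := hN
  have : p.IsPrime := hp.1.1
  obtain ⟨g, hdet, he, hx⟩ := exists_iso_of_isRigidRep Sigma.fst hp.1.2 hs hs'
    (moment_arrowEntries hb) (moment_arrowEntries hc) hps hps'
  refine nonempty_linearEquiv_of_matrixRep b c hdet (semiconj_of_generators _ _ g ?_ ?_)
  · intro i
    rw [hb, hc, he]
  · intro a
    rw [← arrowMat_arrowEntries hb, ← arrowMat_arrowEntries hc, hx]

end Components

end LooplessQuiver

theorem finite_representatives {α κ : Type*} [Finite κ] [Inhabited α] (P : α → Prop)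
    (R : α → κ → Prop) (S : α → α → Prop) (hR : ∀ x, P x → ∃ k, R x k)
    (hS : ∀ x y k, R x k → R y k → S x y) :
    ∃ (n : ℕ) (f : Fin n → α), ∀ x, P x → ∃ i, S x (f i) := by
  classical
  obtain ⟨n, ⟨e⟩⟩ := Finite.exists_equiv_fin κ
  refine ⟨n, fun i => if h : ∃ y, R y (e.symm i) then h.choose else default, fun x hx => ?_⟩
  obtain ⟨k, hk⟩ := hR x hx
  have hk' : R x (e.symm (e k)) := by rwa [e.symm_apply_apply]
  have h : ∃ y, R y (e.symm (e k)) := ⟨x, hk'⟩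
  refine ⟨e k, ?_⟩
  simp only [dif_pos h]
  exact hS x _ _ hk' h.choose_spec

section Bricks

attribute [local instance] ModuleCat.moduleOfAlgebraModule
  ModuleCat.isScalarTower_of_algebra_moduleCat

namespace LooplessQuiver

variable {Q : LooplessQuiver}

theorem IsBrick.exists_isRigidPointOn {M : ModuleCat.{0} Q.Preproj} (hM : Q.IsBrick M)
    (hfin : Q.FinDim M) (hQ : Q.IsDynkin) :
    ∃ d : Q.V → ℕ, Q.form (fun i => d i) (fun i => d i) ≤ 2 ∧
      ∃ p ∈ (repIdeal (Sigma.fst : (Σ i, Fin (d i)) → Q.V)).minimalPrimes,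
        IsRigidPointOn M d p := by
  obtain ⟨⟨m, hm⟩, hend⟩ := hM
  have : FiniteDimensional ℂ M := hfin
  have : Nontrivial M := ⟨m, 0, hm⟩
  refine LooplessQuiver.exists_isRigidPointOn hQ fun f => ?_
  obtain ⟨t, ht⟩ := hend (ModuleCat.ofHom f)
  exact ⟨t, fun m => (ht m).trans (algebraMap_smul Q.Preproj t m)⟩

/-- The irreducible components of the varieties of representations of the preprojective algebra
whose dimension vector is a root. -/
abbrev RootComponents (Q : LooplessQuiver) : Type :=
  Σ d : {d : Q.V → ℕ // Q.form (fun i => d i) (fun i => d i) ≤ 2},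
    (repIdeal (Sigma.fst : (Σ i, Fin (d.1 i)) → Q.V)).minimalPrimes

theorem IsDynkin.finite_rootComponents (hQ : Q.IsDynkin) : Finite Q.RootComponents := by
  have : Finite {d : Q.V → ℕ // Q.form (fun i => d i) (fun i => d i) ≤ 2} := hQ.finite_roots
  have (d : Q.V → ℕ) : Finite (repIdeal (Sigma.fst : (Σ i, Fin (d i)) → Q.V)).minimalPrimes :=
    Ideal.finite_minimalPrimes_of_isNoetherianRing _ _
  infer_instance

theorem IsDynkin.exists_brick_representatives (hQ : Q.IsDynkin) :
    ∃ (n : ℕ) (f : Fin n → ModuleCat.{0} Q.Preproj),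
      ∀ M : ModuleCat.{0} Q.Preproj, Q.FinDim M ∧ Q.IsBrick M → ∃ i, Nonempty (M ≅ f i) := by
  have := hQ.finite_rootComponents
  have : Inhabited (ModuleCat.{0} Q.Preproj) := ⟨ModuleCat.of _ PUnit⟩
  refine finite_representatives (fun M => Q.FinDim M ∧ Q.IsBrick M)
    (fun (M : ModuleCat.{0} Q.Preproj) (k : Q.RootComponents) => IsRigidPointOn M k.1.1 k.2.1)
    (fun M N => Nonempty (M ≅ N)) ?_ ?_
  · rintro M ⟨hfin, hM⟩
    obtain ⟨d, hd, p, hp, h⟩ := hM.exists_isRigidPointOn hfin hQ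
    exact ⟨⟨⟨d, hd⟩, p, hp⟩, h⟩
  · intro M N k hM hN
    obtain ⟨e⟩ := hM.nonempty_linearEquiv k.2.2 hN
    exact ⟨e.toModuleIso⟩

end LooplessQuiver

end Bricks

/-- Let `Q` be a Dynkin quiver.  Then there are only finitely
many bricks in `P(Q)-mod` up to isomorphism. -/
theorem finitely_many_bricks
    (Q : LooplessQuiver) (hQ : Q.IsDynkin) :
    ∃ (n : ℕ) (f : Fin n → ModuleCat.{0} Q.Preproj),
      ∀ M : ModuleCat.{0} Q.Preproj, Q.FinDim M → Q.IsBrick M →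
        ∃ i, Nonempty (M ≅ f i) := by
  obtain ⟨n, f, hf⟩ := hQ.exists_brick_representatives
  exact ⟨n, f, fun M hfin hM => hf M ⟨hfin, hM⟩⟩

end GreenSeqPaper
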